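/- In the braid group B_{n+1} (with generators σ_1,…,σ_n), the Jucys–Murphy element L_{n+1} = FT_n^{−1}·FT_{n+1} commutes with σ_j for every 1 ≤ j ≤ n−1; that is, L_{n+1} commutes with the image of the standard inclusion of B_n into B_{n+1}. -/

import Mathlib

/-- The defining relations of the braid group on `n` strands, as elements of the free group
on the generators `σ_1, …, σ_{n-1}` (indexed here by `Fin (n-1)`, zero-based):
`σ_i σ_{i+1} σ_i = σ_{i+1} σ_i σ_{i+1}` and `σ_i σ_j = σ_j σ_i` for `|i - j| > 1`. -/
def braidRels (n : ℕ) : Set (FreeGroup (Fin (n - 1))) :=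
  {r | (∃ i j : Fin (n - 1), (i : ℕ) + 1 = (j : ℕ) ∧
          r = .of i * .of j * .of i * (.of j * .of i * .of j)⁻¹) ∨
       (∃ i j : Fin (n - 1), (i : ℕ) + 1 < (j : ℕ) ∧
          r = .of i * .of j * (.of j * .of i)⁻¹)}

/-- The braid group on `n` strands: generators `σ_1, …, σ_{n-1}` modulo the braid relations. -/
abbrev BraidGroup (n : ℕ) := PresentedGroup (braidRels n)

/-- The generator `σ_{i+1}` (the crossing of strands `i+1` and `i+2`, zero-based index `i`). -/
def braidGen (n : ℕ) (i : Fin (n - 1)) : BraidGroup n := PresentedGroup.of i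

/-- The partial full twist `FT_k = (σ_1 σ_2 ⋯ σ_{k-1})^k` in the braid group on `n` strands. -/
def fullTwist (n k : ℕ) : BraidGroup n :=
  ((((List.finRange (n - 1)).take (k - 1)).map (braidGen n)).prod) ^ k

/-- The Jucys–Murphy element `L_k = FT_{k-1}⁻¹ · FT_k` (so `L_1 = 1`). -/
def jucysMurphy (n k : ℕ) : BraidGroup n := (fullTwist n (k - 1))⁻¹ * fullTwist n k


section BraidAux
variable {G : Type*} [Group G]

/-- The ordered product `s 0 * ⋯ * s (k-1)`. -/
def ordProd (s : ℕ → G) : ℕ → G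
  | 0 => 1
  | k + 1 => ordProd s k * s k

theorem ordProd_succ_left (s : ℕ → G) (k : ℕ) :
    ordProd s (k + 1) = s 0 * ordProd (fun i => s (i + 1)) k := by
  induction k with
  | zero => simp [ordProd]
  | succ k ih => rw [ordProd, ih, ordProd, mul_assoc]

theorem ordProd_comm (s : ℕ → G) (g : G) (k : ℕ) (h : ∀ i < k, g * s i = s i * g) :
    g * ordProd s k = ordProd s k * g := by
  induction k with
  | zero => simp [ordProd]
  | succ k ih =>
    rw [ordProd, ← mul_assoc, ih (fun i hi => h i (by omega)), mul_assoc, h k (by omega), mul_assoc]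

variable (s : ℕ → G) (m : ℕ)
  (hb : ∀ i, i + 1 < m → s i * s (i + 1) * s i = s (i + 1) * s i * s (i + 1))
  (hc : ∀ i j, i + 1 < j → j < m → s i * s j = s j * s i)

include hb hc

theorem ordProd_shift (k : ℕ) (hk : k ≤ m) (i : ℕ) (hi : i + 1 < k) :
    ordProd s k * s i = s (i + 1) * ordProd s k := by
  induction k with
  | zero => omega
  | succ k ih =>
    rcases Nat.lt_or_ge (i + 1) k with h | h
    · rw [ordProd, mul_assoc, ← hc i k h (by omega), ← mul_assoc, ih (by omega) h, mul_assoc]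
    · obtain rfl : k = i + 1 := by omega
      have h1 := ordProd_comm s (s (i + 1)) i
        (fun j hj => (hc j (i + 1) (by omega) (by omega)).symm)
      have h2 := hb i (by omega)
      simp only [ordProd]
      calc _ = ordProd s i * (s i * s (i + 1) * s i) := by group
        _ = (ordProd s i * s (i + 1)) * s i * s (i + 1) := by rw [h2]; group
        _ = _ := by rw [← h1]; group

theorem ordProd_last (q : ℕ) (hq : q + 1 ≤ m) :
    ordProd s (q + 1) ^ 2 * s q = s 0 * ordProd s (q + 1) ^ 2 := by
  have key : ∀ j ≤ q, ordProd s (q + 1) * ordProd s j =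
      ordProd (fun i => s (i + 1)) j * ordProd s (q + 1) := by
    intro j
    induction j with
    | zero => simp [ordProd]
    | succ j ih =>
      intro hj
      have h3 := ordProd_shift s m hb hc (q + 1) hq j (by omega)
      have h4 := ih (by omega)
      show _ * (ordProd s j * s j) = (ordProd (fun i => s (i + 1)) j * s (j + 1)) * _
      rw [← mul_assoc, h4, mul_assoc, h3, mul_assoc]
  have h1 := key q le_rfl
  have h2 := ordProd_succ_left s q
  calc _ = (s 0 * ordProd (fun i => s (i + 1)) q) * ordProd s (q + 1) * s q := by
        rw [← h2, pow_two]
    _ = s 0 * (ordProd (fun i => s (i + 1)) q * ordProd s (q + 1)) * s q := by group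
    _ = s 0 * (ordProd s (q + 1) * (ordProd s q * s q)) := by rw [← h1]; group
    _ = _ := by rw [pow_two]; rfl

theorem ordProd_pow_shift (k : ℕ) (hk : k ≤ m) (d i : ℕ) (hi : i + d < k) :
    ordProd s k ^ d * s i = s (i + d) * ordProd s k ^ d := by
  induction d with
  | zero => simp
  | succ d ih =>
    rw [pow_succ', mul_assoc, ih (by omega), ← mul_assoc,
      ordProd_shift s m hb hc k hk (i + d) (by omega), mul_assoc]
    rfl

theorem ordProd_central (k : ℕ) (hk : k ≤ m) (i : ℕ) (hi : i < k) :
    Commute (ordProd s k ^ (k + 1)) (s i) := by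
  obtain ⟨q, rfl⟩ : ∃ q, k = q + 1 := ⟨k - 1, by omega⟩
  obtain ⟨d, rfl⟩ : ∃ d, q = i + d := ⟨q - i, by omega⟩
  have h1 := ordProd_pow_shift s m hb hc _ hk d i (by omega)
  have h2 := ordProd_last s m hb hc _ hk
  have h3 := ordProd_pow_shift s m hb hc _ hk i 0 (by omega)
  rw [Nat.zero_add] at h3
  have e : i + d + 1 + 1 = i + (2 + d) := by omega
  show _ * _ = _ * _
  rw [e]
  generalize ordProd s (i + d + 1) = P at *
  rw [pow_add, pow_add, mul_assoc, mul_assoc, h1, ← mul_assoc (P ^ 2), h2, mul_assoc (s 0),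
    ← mul_assoc (P ^ i), h3, mul_assoc]

end BraidAux

/-- The generators extended by `1` to all natural indices. -/
def braidSeq (n : ℕ) (i : ℕ) : BraidGroup n :=
  if h : i < n - 1 then braidGen n ⟨i, h⟩ else 1

theorem braidSeq_of_lt (n i : ℕ) (h : i < n - 1) : braidSeq n i = braidGen n ⟨i, h⟩ := by
  simp [braidSeq, h]

theorem braidSeq_braid (n : ℕ) (i : ℕ) (h : i + 1 < n - 1) :
    braidSeq n i * braidSeq n (i + 1) * braidSeq n i =
      braidSeq n (i + 1) * braidSeq n i * braidSeq n (i + 1) := by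
  rw [braidSeq_of_lt n i (by omega), braidSeq_of_lt n (i + 1) h]
  rw [← mul_inv_eq_one]
  exact PresentedGroup.one_of_mem (rels := braidRels n)
    (Or.inl ⟨⟨i, by omega⟩, ⟨i + 1, h⟩, rfl, rfl⟩)

theorem braidSeq_comm (n : ℕ) (i j : ℕ) (hij : i + 1 < j) (h : j < n - 1) :
    braidSeq n i * braidSeq n j = braidSeq n j * braidSeq n i := by
  rw [braidSeq_of_lt n i (by omega), braidSeq_of_lt n j h]
  rw [← mul_inv_eq_one]
  exact PresentedGroup.one_of_mem (rels := braidRels n)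
    (Or.inr ⟨⟨i, by omega⟩, ⟨j, h⟩, hij, rfl⟩)

theorem take_prod (n k : ℕ) (hk : k ≤ n - 1) :
    (((List.finRange (n - 1)).take k).map (braidGen n)).prod = ordProd (braidSeq n) k := by
  induction k with
  | zero => simp [ordProd]
  | succ k ih =>
    rw [List.take_succ_eq_append_getElem (by simpa using hk), List.map_append, List.prod_append,
      ih (by omega), ordProd, braidSeq_of_lt n k (by omega)]
    simp

theorem fullTwist_comm (n k : ℕ) (hk : k ≤ n - 1) (i : ℕ) (hi : i < k) :
    Commute (fullTwist n (k + 1)) (braidGen n ⟨i, by omega⟩) := by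
  rw [fullTwist, Nat.add_sub_cancel, take_prod n k hk, ← braidSeq_of_lt]
  exact ordProd_central _ (n - 1) (braidSeq_braid n) (braidSeq_comm n) k hk i hi

theorem jm_comm (n i : ℕ) (hi : i < n - 1) :
    Commute (jucysMurphy (n + 1) (n + 1)) (braidGen (n + 1) ⟨i, by omega⟩) := by
  obtain ⟨q, rfl⟩ : ∃ q, n = q + 1 := ⟨n - 1, by omega⟩
  exact (fullTwist_comm (q + 1 + 1) q (by omega) i (by omega)).inv_left.mul_left
    (fullTwist_comm (q + 1 + 1) (q + 1) (by omega) i (by omega))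

/-- In the braid group `B_{n+1}` (with generators `σ_1, …, σ_n`), the
Jucys–Murphy element `L_{n+1} = FT_n⁻¹ · FT_{n+1}` commutes with `σ_j` for every `1 ≤ j ≤ n-1`;
that is, it commutes with every element of the subgroup generated by `σ_1, …, σ_{n-1}`, the
image of the standard inclusion `B_n → B_{n+1}`. -/
theorem jucysMurphy_top_commutes (n : ℕ) :
    (∀ j : ℕ, (h1 : 1 ≤ j) → (h2 : j ≤ n - 1) →
      jucysMurphy (n + 1) (n + 1) * braidGen (n + 1) ⟨j - 1, by omega⟩ =
        braidGen (n + 1) ⟨j - 1, by omega⟩ * jucysMurphy (n + 1) (n + 1)) ∧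
    (∀ g ∈ Subgroup.closure (Set.range fun i : Fin (n - 1) =>
        braidGen (n + 1) ⟨(i : ℕ), by omega⟩),
      jucysMurphy (n + 1) (n + 1) * g = g * jucysMurphy (n + 1) (n + 1)) := by
  refine ⟨fun j h1 h2 => jm_comm n (j - 1) (by omega), fun g hg => ?_⟩
  have hle : Subgroup.closure (Set.range fun i : Fin (n - 1) =>
      braidGen (n + 1) ⟨(i : ℕ), by omega⟩) ≤
      Subgroup.centralizer {jucysMurphy (n + 1) (n + 1)} := by
    rw [Subgroup.closure_le]
    rintro _ ⟨i, rfl⟩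
    exact Subgroup.mem_centralizer_singleton_iff.2 (jm_comm n i i.2).symm
  exact (Subgroup.mem_centralizer_singleton_iff.1 (hle hg)).symm
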